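/- A language L ⊆ Σ* is Π⁰₁ (co-computably-enumerable) if and only if L = L(M) for some Π₁ alternating Turing machine M. -/

import Mathlib

namespace ATMPaper

/-- Actions of a Turing machine: overwrite the scanned symbol by a letter,
move the cursor backward (`left`), or forward (`right`). -/
inductive Act (Γ : Type) : Type
  | write : Γ → Act Γ
  | left : Act Γ
  | right : Act Γ

/-- A cursored tape `u γ̲ v`: the string `u` to the left of the cursor,
the scanned symbol `γ`, and the string `v` to the right. -/
abbrev Tape (Γ : Type) : Type := List Γ × Γ × List Γ

/-- The scanned symbol of a cursored tape. -/
def Tape.scan {Γ : Type} (t : Tape Γ) : Γ := t.2.1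

/-- The effect of an action on a cursored tape (with blank symbol `blank`):
moving forward past the right end extends the tape with a blank, and moving
backward at the left end leaves the cursor in place. -/
inductive ActStep {Γ : Type} (blank : Γ) : Act Γ → Tape Γ → Tape Γ → Prop
  | fwd (u : List Γ) (γ τ : Γ) (v : List Γ) :
      ActStep blank Act.right (u, γ, τ :: v) (u ++ [γ], τ, v)
  | fwdEnd (u : List Γ) (γ : Γ) :
      ActStep blank Act.right (u, γ, []) (u ++ [γ], blank, [])
  | bwd (u : List Γ) (τ γ : Γ) (v : List Γ) :
      ActStep blank Act.left (u ++ [τ], γ, v) (u, τ, γ :: v)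
  | bwdEnd (γ : Γ) (v : List Γ) :
      ActStep blank Act.left ([], γ, v) ([], γ, v)
  | write (u : List Γ) (γ τ : Γ) (v : List Γ) :
      ActStep blank (Act.write τ) (u, γ, v) (u, τ, v)

section Generic

variable {C : Type*} (isE : C → Bool) (step : C → C → Prop)

/-- A chain of steps `c = c₀ → ⋯ → cₙ = c'` (`n ≥ 0`) in which `c₀,…,cₙ₋₁`
are all existential. -/
inductive EChain : C → C → Prop
  | refl (c : C) : EChain c c
  | step {c c' c'' : C} : isE c = true → step c c' → EChain c' c'' → EChain c c''

/-- A chain of steps `c = c₀ → ⋯ → cₙ = c'` (`n ≥ 0`) in which `c₀,…,cₙ₋₁`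
are all universal. -/
inductive UChain : C → C → Prop
  | refl (c : C) : UChain c c
  | step {c c' c'' : C} : isE c = false → step c c' → UChain c' c'' → UChain c c''

/-- `c ⇑∃ c'` : `c'` is universal and reachable from `c` by a chain passing
only through existential configurations. -/
def EPivot (c c' : C) : Prop := EChain isE step c c' ∧ isE c' = false

/-- `c ⇑∀ c'` : `c'` is existential and reachable from `c` by a chain passing
only through universal configurations. -/
def UPivot (c c' : C) : Prop := UChain isE step c c' ∧ isE c' = true

/-- The set `AC` of accepted configurations: the least set `S` such that
(i) an existential `c` with some pivot `c ⇑∃ c'`, `c' ∈ S`, is in `S`, and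
(ii) a universal `c` all of whose pivots `c ⇑∀ c'` lie in `S` is in `S`. -/
inductive Accepted : C → Prop
  | ex {c c' : C} : isE c = true → EPivot isE step c c' → Accepted c' → Accepted c
  | univ {c : C} : isE c = false → (∀ c', UPivot isE step c c' → Accepted c') →
      Accepted c

/-- The set `RC` of rejected configurations: the least set `S` such that
(i) an existential `c` all of whose pivots `c ⇑∃ c'` lie in `S` is in `S`, and
(ii) a universal `c` with some pivot `c ⇑∀ c'`, `c' ∈ S`, is in `S`. -/
inductive Rejected : C → Prop
  | ex {c : C} : isE c = true → (∀ c', EPivot isE step c c' → Rejected c') →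
      Rejected c
  | univ {c c' : C} : isE c = false → UPivot isE step c c' → Rejected c' →
      Rejected c

end Generic

/-- An alternating Turing machine over input alphabet `α`, with (finite)
machine alphabet `Γ` into which `α` embeds, a blank symbol (not a letter
of `α`), a finite set `Q` of states each of which is existential
(`isE q = true`) or universal (`isE q = false`), a start state, and a
transition relation `δ`. -/
structure ATM (α Γ : Type) where
  ΓFin : Finite Γ
  emb : α ↪ Γ
  blank : Γ
  blank_ne : ∀ a : α, emb a ≠ blank
  Q : Type
  QFin : Finite Q
  isE : Q → Bool
  start : Q
  δ : Q → Γ → Act Γ → Q → Prop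

namespace ATM

variable {α Γ : Type} (M : ATM α Γ)

/-- A configuration: a state together with a cursored tape. -/
abbrev Cfg : Type := M.Q × Tape Γ

/-- A configuration is existential or universal according to its state. -/
def cfgE (c : M.Cfg) : Bool := M.isE c.1

/-- The one-step yield relation between configurations. -/
def Yield (c c' : M.Cfg) : Prop :=
  ∃ a : Act Γ, M.δ c.1 (Tape.scan c.2) a c'.1 ∧ ActStep M.blank a c.2 c'.2

/-- `c ⇑∃ c'` for configurations of `M`. -/
def EPiv (c c' : M.Cfg) : Prop := ATMPaper.EPivot M.cfgE M.Yield c c'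

/-- `c ⇑∀ c'` for configurations of `M`. -/
def UPiv (c c' : M.Cfg) : Prop := ATMPaper.UPivot M.cfgE M.Yield c c'

/-- `c` is an accepted configuration of `M`. -/
def Accepted (c : M.Cfg) : Prop := ATMPaper.Accepted M.cfgE M.Yield c

/-- `c` is a rejected configuration of `M`. -/
def Rejected (c : M.Cfg) : Prop := ATMPaper.Rejected M.cfgE M.Yield c

/-- The initial configuration `(s₀, ε, ⊔, w)` for input `w`. -/
def init (w : List α) : M.Cfg := (M.start, ([], M.blank, w.map M.emb))

/-- `M` accepts the input string `w`. -/
def Accepts (w : List α) : Prop := M.Accepted (M.init w)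

/-- `M` rejects the input string `w`. -/
def Rejects (w : List α) : Prop := M.Rejected (M.init w)

/-- The language `L(M)` accepted by `M`. -/
def Lang : Set (List α) := {w | M.Accepts w}

/-- The language `L̄(M)` rejected by `M`. -/
def coLang : Set (List α) := {w | M.Rejects w}

/-- `M` is total: every input is either accepted or rejected. -/
def Total : Prop := ∀ w : List α, M.Accepts w ∨ M.Rejects w

/-- `M` is one-sided: it has no accepted configurations, or no rejected ones. -/
def OneSided : Prop :=
  (∀ c : M.Cfg, ¬ M.Accepted c) ∨ (∀ c : M.Cfg, ¬ M.Rejected c)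

/-- The dual machine: same data, with existential and universal states
interchanged. -/
def dual : ATM α Γ :=
  ⟨M.ΓFin, M.emb, M.blank, M.blank_ne, M.Q, M.QFin,
    fun q => !M.isE q, M.start, M.δ⟩

/-- `M` is alternation well-founded: for no input `w` is there an infinite
sequence of yield-steps from the initial configuration for `w` in which the
type (existential/universal) changes infinitely often. -/
def AltWF : Prop :=
  ∀ w : List α, ¬∃ d : ℕ → M.Cfg, d 0 = M.init w ∧
    (∀ i : ℕ, M.Yield (d i) (d (i + 1))) ∧
    (∀ n : ℕ, ∃ m : ℕ, n ≤ m ∧ M.cfgE (d m) ≠ M.cfgE (d (m + 1)))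

/-- Every chain of yield-steps from an initial configuration of `M` has at
most `k` alternation-pivots, i.e. at most `k` indices at which the type of
the configuration changes. -/
def AltBound (k : ℕ) : Prop :=
  ∀ (w : List α) (n : ℕ) (d : ℕ → M.Cfg), d 0 = M.init w →
    (∀ i < n, M.Yield (d i) (d (i + 1))) →
    ((Finset.range n).filter fun i => M.cfgE (d i) ≠ M.cfgE (d (i + 1))).card ≤ k

/-- `M` is a `Σ_k` machine: its start state is existential and every chain of
yield-steps from an initial configuration has at most `k` alternation-pivots. -/
def IsSigmaM (k : ℕ) : Prop := M.isE M.start = true ∧ M.AltBound k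

/-- `M` is a `Π_k` machine: its start state is universal and every chain of
yield-steps from an initial configuration has at most `k` alternation-pivots;
moreover for `k = 1` no transition rule applies to any existential state. -/
def IsPiM (k : ℕ) : Prop :=
  M.isE M.start = false ∧ M.AltBound k ∧
    (k = 1 → ∀ (q : M.Q) (γ : Γ) (a : Act Γ) (q' : M.Q),
      M.δ q γ a q' → M.isE q = false)

end ATM

/-- `AltQuant α k b P` is the statement `Q₁ x₁ Q₂ x₂ ⋯ Q_k x_k, P (x₁,…,x_k)`
where the quantifiers `Qᵢ` over `List α` alternate, starting with `∃` if
`b = true` and with `∀` if `b = false`. -/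
def AltQuant (α : Type) : (k : ℕ) → Bool → ((Fin k → List α) → Prop) → Prop
  | 0, _, P => P fun i => i.elim0
  | k + 1, true, P => ∃ x : List α, AltQuant α k false fun v => P (Fin.cons x v)
  | k + 1, false, P => ∀ x : List α, AltQuant α k true fun v => P (Fin.cons x v)

/-- `L ⊆ Σ*` is `Σ⁰_k`: definable by `k` alternating quantifiers over strings,
beginning with `∃`, applied to a computable relation. -/
def IsSigma0 (α : Type) [Primcodable α] (k : ℕ) (L : Set (List α)) : Prop :=
  ∃ R : List α × (Fin k → List α) → Prop, ComputablePred R ∧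
    L = {w | AltQuant α k true fun v => R (w, v)}

/-- `L ⊆ Σ*` is `Π⁰_k`: definable by `k` alternating quantifiers over strings,
beginning with `∀`, applied to a computable relation. -/
def IsPi0 (α : Type) [Primcodable α] (k : ℕ) (L : Set (List α)) : Prop :=
  ∃ R : List α × (Fin k → List α) → Prop, ComputablePred R ∧
    L = {w | AltQuant α k false fun v => R (w, v)}

/-- `L ⊆ Σ*` is inductive (`Π¹₁`): there is a computable relation
`R ⊆ Σ* × List (Σ*)` with
`L = {w | ∀ f : ℕ → Σ*, ∃ n, R (w, [f 0, …, f n])}`. -/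
def IsInductive (α : Type) [Primcodable α] (L : Set (List α)) : Prop :=
  ∃ R : List α × List (List α) → Prop, ComputablePred R ∧
    L = {w | ∀ f : ℕ → List α, ∃ n : ℕ, R (w, (List.range (n + 1)).map f)}

/-- A two-tape alternating Turing machine: as `ATM`, but configurations carry
two cursored tapes, and transitions read both scanned symbols and perform an
action on each tape. -/
structure ATM2 (α Γ : Type) where
  ΓFin : Finite Γ
  emb : α ↪ Γ
  blank : Γ
  blank_ne : ∀ a : α, emb a ≠ blank
  Q : Type
  QFin : Finite Q
  isE : Q → Bool
  start : Q
  δ : Q → Γ → Γ → Act Γ → Act Γ → Q → Prop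

namespace ATM2

variable {α Γ : Type} (M : ATM2 α Γ)

/-- A configuration of a two-tape machine: a state and two cursored tapes. -/
abbrev Cfg : Type := M.Q × Tape Γ × Tape Γ

/-- A configuration is existential or universal according to its state. -/
def cfgE (c : M.Cfg) : Bool := M.isE c.1

/-- The one-step yield relation of a two-tape machine. -/
def Yield (c c' : M.Cfg) : Prop :=
  ∃ a₀ a₁ : Act Γ, M.δ c.1 (Tape.scan c.2.1) (Tape.scan c.2.2) a₀ a₁ c'.1 ∧
    ActStep M.blank a₀ c.2.1 c'.2.1 ∧ ActStep M.blank a₁ c.2.2 c'.2.2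

/-- `c ⇑∃ c'` for configurations of `M`. -/
def EPiv (c c' : M.Cfg) : Prop := ATMPaper.EPivot M.cfgE M.Yield c c'

/-- `c ⇑∀ c'` for configurations of `M`. -/
def UPiv (c c' : M.Cfg) : Prop := ATMPaper.UPivot M.cfgE M.Yield c c'

/-- `c` is an accepted configuration of `M`. -/
def Accepted (c : M.Cfg) : Prop := ATMPaper.Accepted M.cfgE M.Yield c

/-- `c` is a rejected configuration of `M`. -/
def Rejected (c : M.Cfg) : Prop := ATMPaper.Rejected M.cfgE M.Yield c

/-- `M` accepts `w`: the configuration reached after the (deterministic)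
pre-processing phase — the start state with the input copied onto both
tapes — is accepted. -/
def Accepts (w : List α) : Prop :=
  M.Accepted (M.start, ([], M.blank, w.map M.emb), ([], M.blank, w.map M.emb))

/-- `M` rejects `w`. -/
def Rejects (w : List α) : Prop :=
  M.Rejected (M.start, ([], M.blank, w.map M.emb), ([], M.blank, w.map M.emb))

end ATM2

/-- The combined two-tape machine `M` of two single-tape machines `M₀`, `M₁`
over a common alphabet. Its states are triples `⟨q₀,q₁,j⟩` (`j : Bool`, with
`false` for `0` and `true` for `1`), typed according to `q_j`. In control
`j = 0`, a rule `(q₀,γ₀,a,p₀)` of `M₀` acts by `a` on tape `0`, leaves tape `1`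
unchanged (re-writing its scanned symbol), and passes to control `0` if `q₀`
and `p₀` are both universal, and to control `1` otherwise; symmetrically, in
control `j = 1`, a rule `(q₁,γ₁,a,p₁)` of `M₁` acts by `a` on tape `1`, leaves
tape `0` unchanged, and passes to control `1` if `q₁` and `p₁` are both
existential, and to control `0` otherwise. -/
def combine {α Γ : Type} (M₀ M₁ : ATM α Γ) : ATM2 α Γ where
  ΓFin := M₀.ΓFin
  emb := M₀.emb
  blank := M₀.blank
  blank_ne := M₀.blank_ne
  Q := M₀.Q × M₁.Q × Bool
  QFin := by haveI := M₀.QFin; haveI := M₁.QFin; infer_instance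
  isE := fun s => cond s.2.2 (M₁.isE s.2.1) (M₀.isE s.1)
  start := (M₀.start, M₁.start, false)
  δ := fun s γ₀ γ₁ a₀ a₁ p =>
    (s.2.2 = false ∧ ∃ p₀ : M₀.Q, M₀.δ s.1 γ₀ a₀ p₀ ∧ a₁ = Act.write γ₁ ∧
        p = (p₀, s.2.1, !(!(M₀.isE s.1) && !(M₀.isE p₀)))) ∨
    (s.2.2 = true ∧ ∃ p₁ : M₁.Q, M₁.δ s.2.1 γ₁ a₁ p₁ ∧ a₀ = Act.write γ₀ ∧
        p = (s.1, p₁, M₁.isE s.2.1 && M₁.isE p₁))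

end ATMPaper

namespace ATMPaper

namespace ATM

variable {α Γ : Type} (M : ATM α Γ)

theorem IsPiM.not_yield {M : ATM α Γ} (h : M.IsPiM 1) {c c' : M.Cfg} (hc : M.cfgE c = true) :
    ¬ M.Yield c c' := by
  rintro ⟨a, ha, -⟩
  have := h.2.2 rfl _ _ _ _ ha
  simp [cfgE, this] at hc

theorem IsPiM.not_accepted {M : ATM α Γ} (h : M.IsPiM 1) {c : M.Cfg} (hc : M.cfgE c = true) :
    ¬ M.Accepted c := by
  intro hacc
  cases hacc with
  | ex _ hp _ =>
    obtain ⟨hch, hu⟩ := hp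
    cases hch with
    | refl => simp [hc] at hu
    | step _ hy _ => exact h.not_yield hc hy
  | univ hu _ => simp [hc] at hu

/-- A machine without transitions out of existential states and with universal start state is a
`Π₁` machine. -/
theorem isPiM_one_of (hs : M.isE M.start = false)
    (hδ : ∀ q γ a q', M.δ q γ a q' → M.isE q = false) : M.IsPiM 1 := by
  refine ⟨hs, ?_, fun _ => hδ⟩
  intro w n d _ hd
  have hsub : ((Finset.range n).filter fun i => M.cfgE (d i) ≠ M.cfgE (d (i + 1))) ⊆ {n - 1} := by
    intro i hi
    simp only [Finset.mem_filter, Finset.mem_range, Finset.mem_singleton] at hi ⊢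
    obtain ⟨hin, hne⟩ := hi
    obtain ⟨a, ha, -⟩ := hd i hin
    have h0 : M.cfgE (d i) = false := hδ _ _ _ _ ha
    have h1 : M.cfgE (d (i + 1)) = true := by
      cases hb : M.cfgE (d (i + 1)) <;> simp_all
    by_contra hcon
    obtain ⟨b, hb, -⟩ := hd (i + 1) (by omega)
    have h2 : M.cfgE (d (i + 1)) = false := hδ _ _ _ _ hb
    simp [h1] at h2
  simpa using Finset.card_le_card hsub

theorem IsPiM.uChain_iff {M : ATM α Γ} (h : M.IsPiM 1) {c c' : M.Cfg} :
    UChain M.cfgE M.Yield c c' ↔ Relation.ReflTransGen M.Yield c c' := by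
  constructor
  · intro hc
    induction hc with
    | refl => exact .refl
    | step _ hy _ ih => exact .head hy ih
  · intro hc
    induction hc using Relation.ReflTransGen.head_induction_on with
    | refl => exact .refl _
    | head hy _ ih =>
      refine .step ?_ hy ih
      obtain ⟨a, ha, -⟩ := hy
      exact h.2.2 rfl _ _ _ _ ha

/-- A `Π₁` machine accepts exactly the inputs from which no existential configuration is
reachable. -/
theorem IsPiM.mem_lang_iff {M : ATM α Γ} (h : M.IsPiM 1) (w : List α) :
    w ∈ M.Lang ↔ ∀ c, Relation.ReflTransGen M.Yield (M.init w) c → M.cfgE c = false := by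
  have h0 : M.cfgE (M.init w) = false := h.1
  constructor
  · intro hacc c hc
    by_contra hce
    rw [Bool.not_eq_false] at hce
    cases hacc with
    | ex he _ _ => simp [h0] at he
    | univ _ hall => exact h.not_accepted hce (hall c ⟨h.uChain_iff.2 hc, hce⟩)
  · intro hall
    refine Accepted.univ h0 fun c hc => ?_
    have := hall c (h.uChain_iff.1 hc.1)
    simp [hc.2] at this

end ATM

section Forward

variable {Γ : Type} (blank : Γ)

/-- The tape resulting from an action. -/
def Act.apply : Act Γ → Tape Γ → Tape Γ
  | .write τ, (u, _, v) => (u, τ, v)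
  | .right, (u, γ, v) => (u ++ [γ], v.head?.getD blank, v.tail)
  | .left, (u, γ, v) =>
    u.reverse.head?.elim (u, γ, v) fun τ => (u.reverse.tail.reverse, τ, γ :: v)

theorem actStep_iff {a : Act Γ} {t t' : Tape Γ} : ActStep blank a t t' ↔ t' = a.apply blank t := by
  constructor
  · rintro (_ | _ | _ | _ | _) <;> simp [Act.apply]
  · rintro rfl
    obtain ⟨u, γ, v⟩ := t
    cases a with
    | write τ => exact .write _ _ _ _
    | right =>
      cases v with
      | nil => exact .fwdEnd _ _
      | cons τ v => exact .fwd _ _ _ _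
    | left =>
      rcases List.eq_nil_or_concat u with rfl | ⟨u, τ, rfl⟩
      · exact .bwdEnd _ _
      · simpa [Act.apply] using ActStep.bwd u τ γ v

instance Act.finite [Finite Γ] : Finite (Act Γ) := by
  refine Finite.of_surjective (fun x : Γ ⊕ Bool => x.elim Act.write fun b => cond b .left .right) ?_
  rintro (τ | _ | _)
  · exact ⟨.inl τ, rfl⟩
  · exact ⟨.inr true, rfl⟩
  · exact ⟨.inr false, rfl⟩

/-- Some primitive recursive coding of a finite type. -/
noncomputable abbrev finitePrimcodable (β : Type) [Finite β] : Primcodable β :=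
  Primcodable.ofEquiv _ (Finite.equivFin β)

theorem Act.primrec_apply [Finite Γ] [Primcodable Γ] [Primcodable (Act Γ)] :
    Primrec₂ (Act.apply blank) := by
  classical
  let isR : Act Γ → Bool := fun a => match a with | .right => true | _ => false
  let isL : Act Γ → Bool := fun a => match a with | .left => true | _ => false
  let sym : Act Γ → Γ := fun a => match a with | .write τ => τ | _ => blank
  have hR : Primrec isR := Primrec.dom_finite _
  have hL : Primrec isL := Primrec.dom_finite _
  have hS : Primrec sym := Primrec.dom_finite _
  have hu : Primrec fun p : Act Γ × Tape Γ => p.2.1 := Primrec.fst.comp Primrec.snd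
  have hγ : Primrec fun p : Act Γ × Tape Γ => p.2.2.1 :=
    Primrec.fst.comp (Primrec.snd.comp Primrec.snd)
  have hv : Primrec fun p : Act Γ × Tape Γ => p.2.2.2 :=
    Primrec.snd.comp (Primrec.snd.comp Primrec.snd)
  have mR : Primrec fun p : Act Γ × Tape Γ =>
      ((p.2.1 ++ [p.2.2.1], p.2.2.2.head?.getD blank, p.2.2.2.tail) : Tape Γ) :=
    Primrec.pair (Primrec.list_append.comp hu (Primrec.list_cons.comp hγ (Primrec.const [])))
      (Primrec.pair (Primrec.option_getD.comp (Primrec.list_head?.comp hv) (Primrec.const blank))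
        (Primrec.list_tail.comp hv))
  have hur : Primrec fun p : Act Γ × Tape Γ => p.2.1.reverse := Primrec.list_reverse.comp hu
  have mL : Primrec fun p : Act Γ × Tape Γ =>
      (p.2.1.reverse.head?.casesOn (p.2.1, p.2.2.1, p.2.2.2)
        fun τ => (p.2.1.reverse.tail.reverse, τ, p.2.2.1 :: p.2.2.2) : Tape Γ) := by
    refine Primrec.option_casesOn (Primrec.list_head?.comp hur) Primrec.snd ?_
    exact Primrec.pair (Primrec.list_reverse.comp (Primrec.list_tail.comp (hur.comp Primrec.fst)))
      (Primrec.pair Primrec.snd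
        (Primrec.list_cons.comp (hγ.comp Primrec.fst) (hv.comp Primrec.fst)))
  have mW : Primrec fun p : Act Γ × Tape Γ => ((p.2.1, sym p.1, p.2.2.2) : Tape Γ) :=
    Primrec.pair hu (Primrec.pair (hS.comp Primrec.fst) hv)
  refine ((Primrec.cond (hR.comp Primrec.fst) mR
    (Primrec.cond (hL.comp Primrec.fst) mL mW))).of_eq ?_
  rintro ⟨a, u, γ, v⟩
  cases a with
  | left => simp only [isR, isL, cond_true, cond_false, Act.apply]; cases u.reverse.head? <;> rfl
  | right => rfl
  | write τ => rfl

end Forward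

namespace ATM

variable {α Γ : Type} (M : ATM α Γ)

theorem pi01_of_isPiM [Finite α] [Nonempty α] [Primcodable α] (h : M.IsPiM 1) :
    ∃ R : List α × List α → Prop, ComputablePred R ∧ M.Lang = {w | ∀ x : List α, R (w, x)} := by
  classical
  have := M.ΓFin
  have := M.QFin
  let _ : Primcodable Γ := finitePrimcodable Γ
  let _ : Primcodable M.Q := finitePrimcodable M.Q
  let _ : Primcodable (Act Γ) := finitePrimcodable (Act Γ)
  let _ : Fintype (Act Γ × M.Q) := Fintype.ofFinite _
  let rules : M.Q × Γ → List (Act Γ × M.Q) := fun p =>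
    (Finset.univ.filter fun x : Act Γ × M.Q => M.δ p.1 p.2 x.1 x.2).toList
  let next : M.Cfg → List M.Cfg := fun c =>
    (rules (c.1, c.2.2.1)).map fun x => (x.2, x.1.apply M.blank c.2)
  have mem_next : ∀ c c', c' ∈ next c ↔ M.Yield c c' := by
    rintro c ⟨q', t'⟩
    simp only [next, rules, List.mem_map, Finset.mem_toList, Finset.mem_filter, Finset.mem_univ,
      true_and, Prod.exists, Prod.mk.injEq, Yield, actStep_iff, Tape.scan]
    constructor
    · rintro ⟨a, q, hδ, rfl, rfl⟩; exact ⟨a, hδ, rfl⟩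
    · rintro ⟨a, hδ, rfl⟩; exact ⟨a, _, hδ, rfl, rfl⟩
  have next_prim : Primrec next := by
    have hr : Primrec rules := Primrec.dom_finite _
    refine Primrec.list_map (hr.comp (Primrec.pair Primrec.fst
      (Primrec.fst.comp (Primrec.snd.comp Primrec.snd)))) ?_
    exact Primrec.pair (Primrec.snd.comp Primrec.snd)
      ((Act.primrec_apply M.blank).comp (Primrec.fst.comp Primrec.snd)
        (Primrec.snd.comp Primrec.fst))
  let reach : List α → ℕ → List M.Cfg := fun w n =>
    Nat.rec [M.init w] (fun _ l => l.flatMap next) n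
  have mem_reach : ∀ w c, Relation.ReflTransGen M.Yield (M.init w) c ↔ ∃ n, c ∈ reach w n := by
    intro w c
    constructor
    · intro hc
      induction hc with
      | refl => exact ⟨0, by simp [reach]⟩
      | tail _ hy ih =>
        obtain ⟨n, hn⟩ := ih
        exact ⟨n + 1, List.mem_flatMap.2 ⟨_, hn, (mem_next _ _).2 hy⟩⟩
    · rintro ⟨n, hn⟩
      induction n generalizing c with
      | zero => rw [List.mem_singleton.1 hn]
      | succ n ih =>
        obtain ⟨b, hb, hbc⟩ := List.mem_flatMap.1 hn
        exact (ih b hb).tail ((mem_next _ _).1 hbc)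
  have init_prim : Primrec M.init := by
    refine Primrec.pair (Primrec.const _) (Primrec.pair (Primrec.const _)
      (Primrec.pair (Primrec.const _) (Primrec.list_map Primrec.id ?_)))
    exact (Primrec.dom_finite M.emb).comp Primrec.snd
  have reach_prim : Primrec fun p : List α × List α => reach p.1 p.2.length := by
    have hbase : Primrec fun p : List α × List α => [M.init p.1] :=
      Primrec.list_cons.comp (init_prim.comp Primrec.fst) (Primrec.const ([] : List M.Cfg))
    have hstep : Primrec₂ fun (_ : List α × List α) (x : ℕ × List M.Cfg) => x.2.flatMap next :=
      Primrec.list_flatMap (Primrec.snd.comp Primrec.snd) (next_prim.comp Primrec.snd)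
    exact Primrec.nat_rec' (Primrec.list_length.comp Primrec.snd) hbase hstep
  refine ⟨fun p => ∀ c ∈ reach p.1 p.2.length, M.cfgE c = false, ?_, ?_⟩
  · have hE : PrimrecPred fun c : M.Cfg => M.cfgE c = false := by
      have h1 : Primrec M.cfgE := (Primrec.dom_finite M.isE).comp Primrec.fst
      exact Primrec.eq.comp h1 (Primrec.const false)
    obtain ⟨_, hp⟩ := (hE.forall_mem_list).comp reach_prim
    exact ⟨inferInstance, hp.to_comp⟩
  · ext w
    rw [h.mem_lang_iff]
    simp only [mem_reach, Set.mem_ofPred_eq]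
    constructor
    · intro H x c hc
      exact H c ⟨_, hc⟩
    · rintro H c ⟨n, hn⟩
      refine H (List.replicate n (Classical.arbitrary α)) c ?_
      simpa using hn

end ATM

end ATMPaper

namespace ATMPaper

/-! ### Simulating a Turing machine with a two-way infinite tape -/

section Encoding

variable {α Γ₀ : Type}

section Marked

/-- The symbols of the simulating machine: a left end marker, the blank symbol, the input letters,
and cells `(l, r, m)`. A cell stores a block of the right half of the simulated tape, split as
`l.reverse ++ r`, and one symbol `m` of the left half. -/
abbrev Sym (α Γ₀ : Type) (B : ℕ) : Type :=
  Option (Option α ⊕ {c : List Γ₀ × List Γ₀ × Γ₀ // c.1.length + c.2.1.length ≤ B})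

variable {B : ℕ}

instance [Finite α] [Finite Γ₀] : Finite (Sym α Γ₀ B) := by
  have : Finite {c : List Γ₀ × List Γ₀ × Γ₀ // c.1.length + c.2.1.length ≤ B} := by
    refine Set.Finite.subset ((List.finite_length_le Γ₀ B).prod
      ((List.finite_length_le Γ₀ B).prod (Set.finite_univ (α := Γ₀)))) ?_
    rintro ⟨l, r, m⟩ h
    have : l.length + r.length ≤ B := h
    refine ⟨?_, ?_, trivial⟩
    · change l.length ≤ B; omega
    · change r.length ≤ B; omega
  infer_instance

/-- The blank symbol of the simulating machine. -/
abbrev Sym.blank : Sym α Γ₀ B := some (.inl none)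

/-- The part of the block before the split, nearest symbol first. -/
def Sym.left : Sym α Γ₀ B → List Γ₀
  | some (.inr c) => c.1.1
  | _ => []

/-- The left end marker occurs exactly at the left end. -/
def Marked (t : Tape (Sym α Γ₀ B)) : Prop :=
  ∃ s, t.1 ++ t.2.1 :: t.2.2 = none :: s ∧ none ∉ s

/-- Well-formed tapes with the cursor in the left half. -/
structure Far (t : Tape (Sym α Γ₀ B)) : Prop where
  marked : Marked t
  before : ∀ x ∈ t.1, Sym.left x = []
  scan : Sym.left t.2.1 = []
  after : ∀ x ∈ t.2.2, Sym.left x = []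

variable {u v : List (Sym α Γ₀ B)} {x y τ : Sym α Γ₀ B}

theorem marked_nil : Marked ([], x, v) ↔ x = none ∧ none ∉ v := by
  simp only [Marked, List.nil_append, List.cons.injEq]
  constructor
  · rintro ⟨s, ⟨rfl, rfl⟩, hs⟩; exact ⟨rfl, hs⟩
  · rintro ⟨rfl, hs⟩; exact ⟨v, ⟨rfl, rfl⟩, hs⟩

theorem marked_cons : Marked (y :: u, x, v) ↔ y = none ∧ none ∉ u ∧ x ≠ none ∧ none ∉ v := by
  simp only [Marked, List.cons_append, List.cons.injEq]
  constructor
  · rintro ⟨s, ⟨rfl, rfl⟩, hs⟩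
    simp only [List.mem_append, List.mem_cons, not_or] at hs
    exact ⟨rfl, hs.1, Ne.symm hs.2.1, hs.2.2⟩
  · rintro ⟨rfl, h1, h2, h3⟩
    refine ⟨_, ⟨rfl, rfl⟩, ?_⟩
    simp only [List.mem_append, List.mem_cons, not_or]
    exact ⟨h1, Ne.symm h2, h3⟩

theorem Marked.write (ht : Marked (u, x, v)) (hx : x ≠ none) (hy : y ≠ none) :
    Marked (u, y, v) := by
  cases u with
  | nil => exact absurd (marked_nil.1 ht).1 hx
  | cons z u => rw [marked_cons] at ht ⊢; exact ⟨ht.1, ht.2.1, hy, ht.2.2.2⟩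

theorem Marked.eq_nil (ht : Marked (u, none, v)) : u = [] := by
  cases u with
  | nil => rfl
  | cons z u => exact absurd rfl (marked_cons.1 ht).2.2.1

theorem Marked.exists_concat (ht : Marked (u, x, v)) (hx : x ≠ none) : ∃ u' τ, u = u' ++ [τ] := by
  rcases List.eq_nil_or_concat' u with rfl | ⟨u', τ, rfl⟩
  · exact absurd (marked_nil.1 ht).1 hx
  · exact ⟨u', τ, rfl⟩

theorem marked_shift : Marked (u ++ [x], τ, v) ↔ Marked (u, x, τ :: v) := by
  simp [Marked]

theorem Marked.extend (ht : Marked (u, x, [])) : Marked (u, x, [Sym.blank]) := by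
  obtain ⟨s, hs, hn⟩ := ht
  refine ⟨s ++ [Sym.blank], ?_, by simpa using hn⟩
  simp only at hs ⊢
  rw [← List.cons_append, ← hs]
  simp

theorem Far.extend (ht : Far (u, x, [])) : Far (u, x, [Sym.blank]) :=
  ⟨ht.marked.extend, ht.before, ht.scan, by simp [Sym.left]⟩

theorem far_shift : Far (u ++ [x], τ, v) ↔ Far (u, x, τ :: v) := by
  constructor
  · rintro ⟨h1, h2, h3, h4⟩
    refine ⟨marked_shift.1 h1, fun y hy => h2 y (by simp [hy]), h2 x (by simp), ?_⟩
    intro y hy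
    rcases List.mem_cons.1 hy with rfl | hy
    · exact h3
    · exact h4 y hy
  · rintro ⟨h1, h2, h3, h4⟩
    refine ⟨marked_shift.2 h1, ?_, h4 τ (by simp), fun y hy => h4 y (by simp [hy])⟩
    intro y hy
    rcases List.mem_append.1 hy with hy | hy
    · exact h2 y hy
    · rwa [List.mem_singleton.1 hy]

@[simp]
theorem Sym.left_none : Sym.left (none : Sym α Γ₀ B) = [] := rfl

end Marked

variable [Inhabited Γ₀]

/-- The doubly infinite tape with the list `l` to the left of the cursor (nearest symbol first) and
`r` from the cursor on. -/
def biTape (l r : List Γ₀) : Turing.Tape Γ₀ :=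
  Turing.Tape.mk' (Turing.ListBlank.mk l) (Turing.ListBlank.mk r)

theorem listBlank_mk_append_default (l : List Γ₀) :
    Turing.ListBlank.mk (l ++ [default]) = Turing.ListBlank.mk l :=
  Quotient.sound' (Or.inr ⟨1, rfl⟩)

theorem biTape_append_left (l r : List Γ₀) : biTape (l ++ [default]) r = biTape l r := by
  simp only [biTape, listBlank_mk_append_default]

theorem biTape_append_right (l r : List Γ₀) : biTape l (r ++ [default]) = biTape l r := by
  simp only [biTape, listBlank_mk_append_default]

theorem biTape_replicate_left (n : ℕ) (r : List Γ₀) :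
    biTape (List.replicate n default) r = biTape [] r := by
  induction n with
  | zero => rfl
  | succ n ih => rw [List.replicate_succ', biTape_append_left, ih]

@[simp]
theorem biTape_head_cons (l : List Γ₀) (c : Γ₀) (r : List Γ₀) : (biTape l (c :: r)).head = c := rfl

theorem biTape_write (l : List Γ₀) (c c' : Γ₀) (r : List Γ₀) :
    (biTape l (c :: r)).write c' = biTape l (c' :: r) := rfl

theorem biTape_move_right (l : List Γ₀) (c : Γ₀) (r : List Γ₀) :
    (biTape l (c :: r)).move .right = biTape (c :: l) r := rfl

theorem biTape_move_left (l : List Γ₀) (c : Γ₀) (r : List Γ₀) :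
    (biTape (c :: l) r).move .left = biTape l (c :: r) := by
  rw [← biTape_move_right, Turing.Tape.move_right_left]

namespace Sym

variable {B : ℕ}

/-- The part of the block after the split. -/
def right (h : α → List Γ₀) : Sym α Γ₀ B → List Γ₀
  | none => []
  | some (.inl none) => [default]
  | some (.inl (some a)) => h a
  | some (.inr c) => c.1.2.1

/-- The stored symbol of the left half of the simulated tape. -/
def far : Sym α Γ₀ B → List Γ₀
  | none => []
  | some (.inl _) => [default]
  | some (.inr c) => [c.1.2.2]

@[simp]
theorem right_none (h : α → List Γ₀) : right h (none : Sym α Γ₀ B) = [] := rfl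

@[simp]
theorem far_none : far (none : Sym α Γ₀ B) = [] := rfl

/-- `x.Holds h l r m` says that `x` represents the cell `(l, r, m)`. -/
structure Holds (h : α → List Γ₀) (x : Sym α Γ₀ B) (l r : List Γ₀) (m : Γ₀) : Prop where
  left : x.left = l
  right : x.right h = r
  far : x.far = [m]

variable {h : α → List Γ₀} {x y : Sym α Γ₀ B} {l r : List Γ₀} {m : Γ₀}

theorem Holds.ne_none (hx : x.Holds h l r m) : x ≠ none := by
  rintro rfl
  cases hx.far

theorem exists_holds_of_length (hlen : l.length + r.length ≤ B) :
    ∃ y : Sym α Γ₀ B, y.Holds h l r m :=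
  ⟨some (.inr ⟨(l, r, m), hlen⟩), rfl, rfl, rfl⟩

theorem exists_holds (hx : x ≠ none) : ∃ m, x.Holds h x.left (x.right h) m := by
  rcases x with _ | _ | c
  · exact absurd rfl hx
  · exact ⟨_, rfl, rfl, rfl⟩
  · exact ⟨_, rfl, rfl, rfl⟩

theorem Holds.length_le (hB : 1 ≤ B) (hh : ∀ a, (h a).length ≤ B) (hx : x.Holds h l r m) :
    l.length + r.length ≤ B := by
  obtain ⟨rfl, rfl, -⟩ := hx
  rcases x with _ | ⟨_ | a⟩ | c
  · simp [Sym.left, Sym.right]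
  · simpa [Sym.left, Sym.right] using hB
  · simpa [Sym.left, Sym.right] using hh a
  · exact c.2

end Sym

variable {B : ℕ} (h : α → List Γ₀)

/-- The tape contents represented by a cursored tape when the cursor is in the right half. -/
def nearTape (t : Tape (Sym α Γ₀ B)) : Turing.Tape Γ₀ :=
  biTape (t.2.1.left ++ t.1.reverse.flatMap Sym.left ++ (t.1 ++ t.2.1 :: t.2.2).flatMap Sym.far)
    (t.2.1.right h ++ t.2.2.flatMap (Sym.right h))

/-- The tape contents represented by a cursored tape when the cursor is in the left half. -/
def farTape (t : Tape (Sym α Γ₀ B)) : Turing.Tape Γ₀ :=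
  biTape (t.2.2.flatMap Sym.far)
    (t.2.1.far ++ t.1.reverse.flatMap Sym.far ++ (t.1 ++ t.2.1 :: t.2.2).flatMap (Sym.right h))

/-- Well-formed tapes with the cursor in the right half. -/
structure Near (t : Tape (Sym α Γ₀ B)) : Prop where
  marked : Marked t
  before : ∀ x ∈ t.1, Sym.right h x = []
  after : ∀ x ∈ t.2.2, Sym.left x = []

variable {h} {u v : List (Sym α Γ₀ B)} {x y τ : Sym α Γ₀ B} {l r : List Γ₀} {m : Γ₀}

theorem Near.extend (ht : Near h (u, x, [])) : Near h (u, x, [Sym.blank]) :=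
  ⟨ht.marked.extend, ht.before, by simp [Sym.left]⟩

theorem nearTape_extend : nearTape h (u, x, [Sym.blank]) = nearTape h (u, x, []) := by
  simp only [nearTape, List.flatMap_append, List.flatMap_cons, List.flatMap_nil, List.append_nil]
  simp only [Sym.far, Sym.right, ← List.append_assoc]
  rw [biTape_append_left, biTape_append_right]

theorem farTape_extend : farTape h (u, x, [Sym.blank]) = farTape h (u, x, []) := by
  simp only [farTape, List.flatMap_append, List.flatMap_cons, List.flatMap_nil, List.append_nil]
  simp only [Sym.far, Sym.right, ← List.append_assoc]
  rw [biTape_append_right, ← List.nil_append [default], biTape_append_left]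

theorem Near.write {l' r' : List Γ₀} {m' : Γ₀} (ht : Near h (u, x, v)) (hx : x.Holds h l r m)
    (hy : y.Holds h l' r' m') : Near h (u, y, v) :=
  ⟨ht.marked.write hx.ne_none hy.ne_none, ht.before, ht.after⟩

theorem Far.write {r' : List Γ₀} {m' : Γ₀} (ht : Far (u, x, v)) (hx : x.Holds h l r m)
    (hy : y.Holds h [] r' m') : Far (u, y, v) :=
  ⟨ht.marked.write hx.ne_none hy.ne_none, ht.before, hy.left, ht.after⟩

theorem Near.shift (ht : Near h (u, x, τ :: v)) (hx : x.right h = []) :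
    Near h (u ++ [x], τ, v) := by
  refine ⟨marked_shift.2 ht.marked, ?_, fun y hy => ht.after y (by simp [hy])⟩
  intro y hy
  rcases List.mem_append.1 hy with hy | hy
  · exact ht.before y hy
  · rwa [List.mem_singleton.1 hy]

theorem Near.unshift (ht : Near h (u ++ [x], τ, v)) (hx : τ.left = []) :
    Near h (u, x, τ :: v) := by
  refine ⟨marked_shift.1 ht.marked, fun y hy => ht.before y (by simp [hy]), ?_⟩
  intro y hy
  rcases List.mem_cons.1 hy with rfl | hy
  · exact hx
  · exact ht.after y hy

theorem nearTape_shift (hx : x.right h = []) (hτ : τ.left = []) :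
    nearTape h (u ++ [x], τ, v) = nearTape h (u, x, τ :: v) := by
  simp [nearTape, hx, hτ]

theorem exists_nearTape (u v : List (Sym α Γ₀ B)) (x : Sym α Γ₀ B) :
    ∃ L R, ∀ y : Sym α Γ₀ B, y.far = x.far → nearTape h (u, y, v) = biTape (y.left ++ L)
      (y.right h ++ R) := by
  refine ⟨u.reverse.flatMap Sym.left ++ (u ++ x :: v).flatMap Sym.far, v.flatMap (Sym.right h), ?_⟩
  intro y hy
  simp [nearTape, hy]

theorem nearTape_eq (u v : List (Sym α Γ₀ B)) (hx : x.Holds h l r m) :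
    ∃ L R, nearTape h (u, x, v) = biTape (l ++ L) (r ++ R) ∧
      ∀ l' r', ∀ y : Sym α Γ₀ B, y.Holds h l' r' m →
        nearTape h (u, y, v) = biTape (l' ++ L) (r' ++ R) := by
  obtain ⟨L, R, H⟩ := exists_nearTape (h := h) u v x
  refine ⟨L, R, ?_, fun l' r' y hy => ?_⟩
  · rw [H x rfl, hx.left, hx.right]
  · rw [H y (hy.far.trans hx.far.symm), hy.left, hy.right]

theorem far_nearTape (ht : Near h ([], none, τ :: v)) :
    Far ([none], τ, v) ∧ farTape h ([none], τ, v) = (nearTape h ([], none, τ :: v)).move .left := by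
  have hm := ht.marked
  rw [marked_nil] at hm
  refine ⟨⟨marked_shift.2 ht.marked, by simp [Sym.left], ht.after τ (by simp),
    fun y hy => ht.after y (by simp [hy])⟩, ?_⟩
  obtain ⟨m, hτ⟩ := Sym.exists_holds (h := h) (x := τ) (by rintro rfl; simp at hm)
  simp [farTape, nearTape, hτ.far, biTape_move_left]

theorem near_farTape (ht : Far ([], none, v)) :
    Near h ([], none, v) ∧ nearTape h ([], none, v) = farTape h ([], none, v) := by
  refine ⟨⟨ht.marked, by simp, ht.after⟩, ?_⟩
  simp [farTape, nearTape, Sym.far, Sym.right, Sym.left]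

theorem Far.farTape_write {c c' : Γ₀} (hx : x.Holds h [] r c)
    (hy : y.Holds h [] r c') : farTape h (u, y, v) = (farTape h (u, x, v)).write c' := by
  simp only [farTape, hx.far, hy.far, List.cons_append, biTape_write, List.flatMap_append,
    List.flatMap_cons, hx.right, hy.right]

theorem farTape_head {c : Γ₀} (hx : x.Holds h l r c) : (farTape h (u, x, v)).head = c := by
  simp [farTape, hx.far]

theorem farTape_move_right {c : Γ₀} (hx : x.Holds h l r c) :
    farTape h (u, τ, x :: v) = (farTape h (u ++ [τ], x, v)).move .right := by
  simp [farTape, hx.far, biTape_move_right]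

theorem farTape_move_left (hτ : τ ≠ none) :
    farTape h (u ++ [x], τ, v) = (farTape h (u, x, τ :: v)).move .left := by
  obtain ⟨m, hτ⟩ := Sym.exists_holds (h := h) hτ
  simp [farTape, hτ.far, biTape_move_left]

theorem near_input {w : List α} {x : Sym α Γ₀ B} {v : List (Sym α Γ₀ B)}
    (hx : x :: v = (if w = [] then [Sym.blank] else w.map fun a => some (.inl (some a)))) :
    Near h ([none], x, v) ∧ nearTape h ([none], x, v) = biTape [] (w.flatMap h) := by
  have hmem : ∀ y ∈ x :: v, ∃ z, y = some (.inl z) := by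
    rw [hx]
    split_ifs with hw
    · simp [Sym.blank]
    · simp only [List.mem_map]
      rintro _ ⟨a, -, rfl⟩
      exact ⟨_, rfl⟩
  have hleft : ∀ y ∈ x :: v, Sym.left y = [] := by
    intro y hy
    obtain ⟨z, rfl⟩ := hmem y hy
    rfl
  have hfar : (x :: v).flatMap Sym.far = List.replicate (x :: v).length (default : Γ₀) := by
    generalize x :: v = s at hmem
    induction s with
    | nil => rfl
    | cons y s ih =>
      obtain ⟨z, rfl⟩ := hmem y (by simp)
      rw [List.flatMap_cons, ih fun y hy => hmem y (by simp [hy]), List.length_cons,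
        List.replicate_succ]
      rfl
  refine ⟨⟨marked_cons.2 ⟨rfl, by simp, ?_, ?_⟩, by simp, fun y hy => hleft y (by simp [hy])⟩, ?_⟩
  · obtain ⟨z, rfl⟩ := hmem x (by simp)
    simp
  · intro hn
    obtain ⟨z, hz⟩ := hmem none (by simp [hn])
    simp at hz
  · have h1 : nearTape h ([none], x, v) = biTape ((x :: v).flatMap Sym.far)
        ((x :: v).flatMap (Sym.right h)) := by
      simp [nearTape, hleft x (by simp)]
    rw [h1, hfar, biTape_replicate_left, hx]
    split_ifs with hw
    · simp only [hw, List.flatMap_cons, List.flatMap_nil, List.append_nil, Sym.right]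
      exact biTape_append_right [] []
    · rw [List.flatMap_map]
      rfl

end Encoding

end ATMPaper

namespace ATMPaper

/-- The states of the simulating machine: writing the end marker, changing the first simulated
symbol, rejecting, and simulating with the cursor in the right half, with the cursor in the right
half but one simulated cell too far right, or with the cursor in the left half. -/
inductive SimState (Λ : Type) : Type
  | start
  | setup
  | rej
  | run (q : Λ)
  | back (q : Λ)
  | far (q : Λ)

instance {Λ : Type} [Finite Λ] : Finite (SimState Λ) := by
  refine Finite.of_surjective (fun x : Fin 3 ⊕ Fin 3 × Λ =>
    x.elim ![SimState.start, .setup, .rej] fun p => ![SimState.run, .back, .far] p.1 p.2) ?_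
  rintro (_ | _ | _ | q | q | q)
  · exact ⟨.inl 0, rfl⟩
  · exact ⟨.inl 1, rfl⟩
  · exact ⟨.inl 2, rfl⟩
  · exact ⟨.inr (0, q), rfl⟩
  · exact ⟨.inr (1, q), rfl⟩
  · exact ⟨.inr (2, q), rfl⟩

section Simulates

variable {α Γ₀ Λ : Type} [Inhabited Γ₀] {S : Set Λ} {h : α → List Γ₀} {B : ℕ}

variable (h) in
/-- `Simulates h c d` says that `c` encodes the configuration `d` of the simulated machine. -/
inductive Simulates : SimState S × Tape (Sym α Γ₀ B) → Turing.TM0.Cfg Γ₀ Λ → Prop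
  | run (q : S) {t} : Near h t → Simulates (.run q, t) ⟨q, nearTape h t⟩
  | back (q : S) {t} : Near h t → Simulates (.back q, t) ⟨q, (nearTape h t).move .left⟩
  | far (q : S) {t} : Far t → Simulates (.far q, t) ⟨q, farTape h t⟩

variable {q : S} {u v : List (Sym α Γ₀ B)} {x y τ : Sym α Γ₀ B} {l r : List Γ₀} {c m : Γ₀}

theorem simulates_skip (ht : Near h (u, x, τ :: v)) (hx : x.right h = []) :
    Simulates h (.run q, u ++ [x], τ, v)
      ⟨q, nearTape h (u, x, τ :: v)⟩ := by
  rw [← nearTape_shift hx (ht.after τ (by simp))]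
  exact .run q (ht.shift hx)

theorem simulates_back (ht : Near h (u, x, v)) (hx : x.Holds h (c :: l) r m)
    (hy : y.Holds h l (c :: r) m) :
    Simulates h (.run q, u, y, v)
      ⟨q, (nearTape h (u, x, v)).move .left⟩ := by
  obtain ⟨L, R, h1, h2⟩ := nearTape_eq u v hx
  rw [h1, List.cons_append, biTape_move_left, ← List.cons_append, ← h2 _ _ y hy]
  exact .run q (ht.write hx hy)

theorem simulates_backSkip (ht : Near h (u ++ [y], x, v)) (hx : x.left = []) :
    Simulates h (.back q, u, y, x :: v)
      ⟨q, (nearTape h (u ++ [y], x, v)).move .left⟩ := by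
  rw [nearTape_shift (ht.before y (by simp)) hx]
  exact .back q (ht.unshift hx)

theorem simulates_backMark (ht : Near h (u, none, τ :: v)) :
    Simulates h (.far q, u ++ [none], τ, v)
      ⟨q, (nearTape h (u, none, τ :: v)).move .left⟩ := by
  obtain rfl := ht.marked.eq_nil
  rw [← (far_nearTape ht).2]
  exact .far q (far_nearTape ht).1

theorem simulates_farMark (ht : Far (u, none, τ :: v)) :
    Simulates h (.run q, u ++ [none], τ, v)
      ⟨q, farTape h (u, none, τ :: v)⟩ := by
  obtain rfl := ht.marked.eq_nil
  rw [← (near_farTape ht).2]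
  exact simulates_skip (near_farTape ht).1 rfl

end Simulates

section Simulation

variable {α Γ₀ Λ : Type} [Inhabited Γ₀] [Inhabited Λ] (M : Turing.TM0.Machine Γ₀ Λ) (S : Set Λ)
  (h : α → List Γ₀) (g : Γ₀ → Γ₀) (q₀ : S) (B : ℕ)

/-- The transitions of the machine simulating `M`. -/
inductive SimTrans : SimState S → Sym α Γ₀ B → Act (Sym α Γ₀ B) → SimState S → Prop
  | start (x) : SimTrans .start x (.write none) .setup
  | setupMark : SimTrans .setup none .right .setup
  | setup {x y l c r m} : x.Holds h l (c :: r) m → y.Holds h l (g c :: r) m →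
      SimTrans .setup x (.write y) (.run q₀)
  | runSkip {q x} : x.right h = [] → SimTrans (.run q) x .right (.run q)
  | runHalt {q x l c r m} : x.Holds h l (c :: r) m → M q.1 c = none →
      SimTrans (.run q) x (.write x) .rej
  | runWrite {q q' x y l c c' r m} : x.Holds h l (c :: r) m → y.Holds h l (c' :: r) m →
      M q.1 c = some (q'.1, .write c') → SimTrans (.run q) x (.write y) (.run q')
  | runRight {q q' x y l c r m} : x.Holds h l (c :: r) m → y.Holds h (c :: l) r m →
      M q.1 c = some (q'.1, .move .right) → SimTrans (.run q) x (.write y) (.run q')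
  | runLeft {q q' x l c r m} : x.Holds h l (c :: r) m →
      M q.1 c = some (q'.1, .move .left) → SimTrans (.run q) x (.write x) (.back q')
  | back {q x y l c r m} : x.Holds h (c :: l) r m → y.Holds h l (c :: r) m →
      SimTrans (.back q) x (.write y) (.run q)
  | backSkip {q x r m} : x.Holds h [] r m → SimTrans (.back q) x .left (.back q)
  | backMark {q} : SimTrans (.back q) none .right (.far q)
  | farMark {q} : SimTrans (.far q) none .right (.run q)
  | farHalt {q x l r c} : x.Holds h l r c → M q.1 c = none → SimTrans (.far q) x (.write x) .rej
  | farWrite {q q' x y r c c'} : x.Holds h [] r c → y.Holds h [] r c' →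
      M q.1 c = some (q'.1, .write c') → SimTrans (.far q) x (.write y) (.far q')
  | farRight {q q' x r c} : x.Holds h [] r c → M q.1 c = some (q'.1, .move .right) →
      SimTrans (.far q) x .left (.far q')
  | farLeft {q q' x r c} : x.Holds h [] r c → M q.1 c = some (q'.1, .move .left) →
      SimTrans (.far q) x .right (.far q')

/-- The machine simulating `M`, all of whose states but the rejecting one are universal. -/
def simATM [Finite α] [Finite Γ₀] (hS : S.Finite) : ATM α (Sym α Γ₀ B) where
  ΓFin := inferInstance
  emb := ⟨fun a => some (.inl (some a)), fun a b hab => by simpa using hab⟩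
  blank := Sym.blank
  blank_ne := fun a hab => Option.some_ne_none a (Sum.inl.inj (Option.some.inj hab))
  Q := SimState S
  QFin := by have := hS.to_subtype; infer_instance
  isE := fun q => match q with | .rej => true | _ => false
  start := .start
  δ := SimTrans M S h g q₀ B

variable {M S h g q₀ B}

theorem step_eq_none {q : Λ} {T : Turing.Tape Γ₀} (hM : M q T.head = none) :
    Turing.TM0.step M ⟨q, T⟩ = none := by
  simp [Turing.TM0.step, hM]

theorem step_write {q q' : Λ} {T : Turing.Tape Γ₀} {c : Γ₀}
    (hM : M q T.head = some (q', .write c)) :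
    Turing.TM0.step M ⟨q, T⟩ = some ⟨q', T.write c⟩ := by
  simp [Turing.TM0.step, hM]

theorem step_move {q q' : Λ} {T : Turing.Tape Γ₀} {d : Turing.Dir}
    (hM : M q T.head = some (q', .move d)) :
    Turing.TM0.step M ⟨q, T⟩ = some ⟨q', T.move d⟩ := by
  simp [Turing.TM0.step, hM]

section Steps

variable {q q' : S} {u v : List (Sym α Γ₀ B)} {x y τ : Sym α Γ₀ B} {l r : List Γ₀} {c c' m : Γ₀}

theorem simulates_halt (hx : x.Holds h l (c :: r) m)
    (hM : M q c = none) : Turing.TM0.step M ⟨q, nearTape h (u, x, v)⟩ = none := by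
  obtain ⟨L, R, h1, h2⟩ := nearTape_eq u v hx
  refine step_eq_none ?_
  rwa [h1, List.cons_append, biTape_head_cons]

theorem simulates_write (ht : Near h (u, x, v)) (hx : x.Holds h l (c :: r) m)
    (hy : y.Holds h l (c' :: r) m) (hM : M q c = some (q'.1, .write c')) :
    ∃ d', Turing.TM0.step M ⟨q, nearTape h (u, x, v)⟩ = some d' ∧
      Simulates h (.run q', u, y, v) d' := by
  obtain ⟨L, R, h1, h2⟩ := nearTape_eq u v hx
  refine ⟨_, step_write (q' := q'.1) (c := c') ?_, ?_⟩
  · rwa [h1, List.cons_append, biTape_head_cons]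
  · rw [h1, List.cons_append, biTape_write, ← List.cons_append, ← h2 _ _ y hy]
    exact .run q' (ht.write hx hy)

theorem simulates_right (ht : Near h (u, x, v)) (hx : x.Holds h l (c :: r) m)
    (hy : y.Holds h (c :: l) r m) (hM : M q c = some (q'.1, .move .right)) :
    ∃ d', Turing.TM0.step M ⟨q, nearTape h (u, x, v)⟩ = some d' ∧
      Simulates h (.run q', u, y, v) d' := by
  obtain ⟨L, R, h1, h2⟩ := nearTape_eq u v hx
  refine ⟨_, step_move (q' := q'.1) (d := .right) ?_, ?_⟩
  · rwa [h1, List.cons_append, biTape_head_cons]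
  · rw [h1, List.cons_append, biTape_move_right, ← List.cons_append, ← h2 _ _ y hy]
    exact .run q' (ht.write hx hy)

theorem simulates_left (ht : Near h (u, x, v)) (hx : x.Holds h l (c :: r) m)
    (hM : M q c = some (q'.1, .move .left)) :
    ∃ d', Turing.TM0.step M ⟨q, nearTape h (u, x, v)⟩ = some d' ∧
      Simulates h (.back q', u, x, v) d' := by
  obtain ⟨L, R, h1, -⟩ := nearTape_eq u v hx
  refine ⟨_, step_move (q' := q'.1) (d := .left) ?_, .back q' ht⟩
  rwa [h1, List.cons_append, biTape_head_cons]

theorem simulates_farWrite (ht : Far (u, x, v)) (hx : x.Holds h [] r c)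
    (hy : y.Holds h [] r c') (hM : M q c = some (q'.1, .write c')) :
    ∃ d', Turing.TM0.step M ⟨q, farTape h (u, x, v)⟩ = some d' ∧
      Simulates h (.far q', u, y, v) d' := by
  refine ⟨_, step_write (q' := q'.1) (c := c') (by rwa [farTape_head hx]), ?_⟩
  rw [← Far.farTape_write hx hy]
  exact .far q' (ht.write hx hy)

theorem simulates_farRight (ht : Far (u ++ [τ], x, v)) (hx : x.Holds h [] r c)
    (hM : M q c = some (q'.1, .move .right)) :
    ∃ d', Turing.TM0.step M ⟨q, farTape h (u ++ [τ], x, v)⟩ = some d' ∧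
      Simulates h (.far q', u, τ, x :: v) d' := by
  refine ⟨_, step_move (q' := q'.1) (d := .right) (by rwa [farTape_head hx]), ?_⟩
  rw [← farTape_move_right hx]
  exact .far q' (far_shift.1 ht)

theorem simulates_farLeft (ht : Far (u, x, τ :: v)) (hx : x.Holds h [] r c)
    (hM : M q c = some (q'.1, .move .left)) :
    ∃ d', Turing.TM0.step M ⟨q, farTape h (u, x, τ :: v)⟩ = some d' ∧
      Simulates h (.far q', u ++ [x], τ, v) d' := by
  refine ⟨_, step_move (q' := q'.1) (d := .left) (by rwa [farTape_head hx]), ?_⟩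
  have hτ : τ ≠ none := by
    have := far_shift.2 ht
    obtain ⟨u', y, hu⟩ | rfl : (∃ u' y, u = y :: u') ∨ u = [] := by cases u <;> simp
    · subst hu; exact (marked_cons.1 this.marked).2.2.1
    · exact (marked_cons.1 this.marked).2.2.1
  rw [← farTape_move_left hτ]
  exact .far q' (far_shift.2 ht)

end Steps

variable [Finite α] [Finite Γ₀] {hS : S.Finite}

theorem simATM_isPiM : (simATM M S h g q₀ B hS).IsPiM 1 := by
  refine ATM.isPiM_one_of _ rfl ?_
  rintro q γ a q' (_ | _ | _ | _ | _ | _ | _ | _ | _ | _ | _ | _ | _ | _ | _ | _) <;> rfl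

theorem simATM_isE {q} : (simATM M S h g q₀ B hS).isE q = true ↔ q = .rej := by
  cases q <;> simp [simATM]

theorem yield_write {q q' : SimState S} {u v x y} (ht : SimTrans M S h g q₀ B q x (.write y) q') :
    (simATM M S h g q₀ B hS).Yield (q, u, x, v) (q', u, y, v) :=
  ⟨_, ht, .write _ _ _ _⟩

theorem yield_right {q q' : SimState S} {u v x y} (ht : SimTrans M S h g q₀ B q x .right q') :
    (simATM M S h g q₀ B hS).Yield (q, u, x, y :: v) (q', u ++ [x], y, v) :=
  ⟨_, ht, .fwd _ _ _ _⟩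

theorem yield_right_nil {q q' : SimState S} {u x} (ht : SimTrans M S h g q₀ B q x .right q') :
    (simATM M S h g q₀ B hS).Yield (q, u, x, []) (q', u ++ [x], Sym.blank, []) :=
  ⟨_, ht, .fwdEnd _ _⟩

theorem yield_left {q q' : SimState S} {u v x y} (ht : SimTrans M S h g q₀ B q x .left q') :
    (simATM M S h g q₀ B hS).Yield (q, u ++ [y], x, v) (q', u, y, x :: v) :=
  ⟨_, ht, .bwd _ _ _ _⟩

/-- Every step of the simulating machine performs at most one step of the simulated machine, and
rejection occurs only if the simulated machine halts. -/
theorem Simulates.sound {c c' : (simATM M S h g q₀ B hS).Cfg} {d : Turing.TM0.Cfg Γ₀ Λ}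
    (hc : Simulates h c d) (hy : (simATM M S h g q₀ B hS).Yield c c') :
    Simulates h c' d ∨ (∃ d', Turing.TM0.step M d = some d' ∧ Simulates h c' d') ∨
      Turing.TM0.step M d = none := by
  obtain ⟨a, ha, hact⟩ := hy
  obtain ⟨p', t'⟩ := c'
  cases hc with
  | @run q t ht =>
    obtain ⟨u, x, v⟩ := t
    cases ha with
    | runSkip hx =>
      left
      cases hact with
      | fwd u _ τ v => exact simulates_skip ht hx
      | fwdEnd => rw [← nearTape_extend]; exact simulates_skip ht.extend hx
    | runHalt hx hM => exact .inr (.inr (simulates_halt hx hM))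
    | runWrite hx hy hM => cases hact; exact .inr (.inl (simulates_write ht hx hy hM))
    | runRight hx hy hM => cases hact; exact .inr (.inl (simulates_right ht hx hy hM))
    | runLeft hx hM => cases hact; exact .inr (.inl (simulates_left ht hx hM))
  | @back q t ht =>
    left
    obtain ⟨u, x, v⟩ := t
    cases ha with
    | back hx hy => cases hact; exact simulates_back ht hx hy
    | backSkip hx =>
      cases hact with
      | bwd u τ _ v => exact simulates_backSkip ht hx.left
      | bwdEnd => exact .back q ht
    | backMark =>
      cases hact with
      | fwd u _ τ v => exact simulates_backMark ht
      | fwdEnd => rw [← nearTape_extend]; exact simulates_backMark ht.extend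
  | @far q t ht =>
    obtain ⟨u, x, v⟩ := t
    cases ha with
    | farMark =>
      left
      cases hact with
      | fwd u _ τ v => exact simulates_farMark ht
      | fwdEnd => rw [← farTape_extend]; exact simulates_farMark ht.extend
    | farHalt hx hM => exact .inr (.inr (step_eq_none ((farTape_head hx).symm ▸ hM)))
    | farWrite hx hy hM => cases hact; exact .inr (.inl (simulates_farWrite ht hx hy hM))
    | farRight hx hM =>
      cases hact with
      | bwd u τ _ v => exact .inr (.inl (simulates_farRight ht hx hM))
      | bwdEnd => exact absurd (marked_nil.1 ht.marked).1 hx.ne_none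
    | farLeft hx hM =>
      right; left
      cases hact with
      | fwd u _ τ v => exact simulates_farLeft ht hx hM
      | fwdEnd => rw [← farTape_extend]; exact simulates_farLeft ht.extend hx hM

/-- A configuration that performs a step of the simulated machine or rejects. -/
def Ready : SimState S × Tape (Sym α Γ₀ B) → Prop
  | (.run _, _, x, _) => x.right h ≠ []
  | (.far _, _, x, _) => x ≠ none
  | _ => False

theorem exists_ready_run {q : S} {v : List (Sym α Γ₀ B)} :
    ∀ {u : List (Sym α Γ₀ B)} {x : Sym α Γ₀ B}, Near h (u, x, v) →
    ∃ c', Relation.ReflTransGen (simATM M S h g q₀ B hS).Yield (.run q, u, x, v) c' ∧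
      Simulates h c' ⟨q, nearTape h (u, x, v)⟩ ∧ Ready (h := h) c' := by
  induction v with
  | nil =>
    intro u x ht
    by_cases hx : x.right h = []
    · have h1 := simulates_skip (q := q) ht.extend hx
      rw [nearTape_extend] at h1
      exact ⟨_, .single (yield_right_nil (.runSkip hx)), h1, by simp [Ready, Sym.right]⟩
    · exact ⟨_, .refl, .run q ht, hx⟩
  | cons τ v ih =>
    intro u x ht
    by_cases hx : x.right h = []
    · obtain ⟨c', h1, h2, h3⟩ := ih (ht.shift hx)
      rw [nearTape_shift hx (ht.after τ (by simp))] at h2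
      exact ⟨c', .head (yield_right (.runSkip hx)) h1, h2, h3⟩
    · exact ⟨_, .refl, .run q ht, hx⟩

theorem exists_ready_back {q : S} (hB : 1 ≤ B) (hh : ∀ a, (h a).length ≤ B)
    {u : List (Sym α Γ₀ B)} :
    ∀ {x : Sym α Γ₀ B} {v : List (Sym α Γ₀ B)}, Near h (u, x, v) →
    ∃ c', Relation.ReflTransGen (simATM M S h g q₀ B hS).Yield (.back q, u, x, v) c' ∧
      Simulates h c' ⟨q, (nearTape h (u, x, v)).move .left⟩ ∧ Ready (h := h) c' := by
  have main : ∀ {u} {x : Sym α Γ₀ B} {v : List (Sym α Γ₀ B)} {c l}, x.left = c :: l →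
      Near h (u, x, v) →
      ∃ c', Relation.ReflTransGen (simATM M S h g q₀ B hS).Yield (.back q, u, x, v) c' ∧
        Simulates h c' ⟨q, (nearTape h (u, x, v)).move .left⟩ ∧ Ready (h := h) c' := by
    intro u x v c l hx ht
    obtain ⟨m, hm⟩ := Sym.exists_holds (h := h) (x := x) (by rintro rfl; simp at hx)
    rw [hx] at hm
    have hlen := hm.length_le hB hh
    obtain ⟨y, hy⟩ := Sym.exists_holds_of_length (h := h) (l := l) (r := c :: x.right h) (m := m)
      (B := B) (by simp only [List.length_cons] at hlen ⊢; omega)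
    exact ⟨_, .single (yield_write (.back hm hy)), simulates_back ht hm hy, by
      simp [Ready, hy.right]⟩
  induction u using List.reverseRecOn with
  | nil =>
    intro x v ht
    obtain ⟨rfl, hv⟩ := marked_nil.1 ht.marked
    cases v with
    | nil =>
      have h1 := simulates_backMark (q := q) ht.extend
      rw [nearTape_extend] at h1
      exact ⟨_, .single (yield_right_nil .backMark), h1, by simp [Ready]⟩
    | cons τ v =>
      refine ⟨_, .single (yield_right .backMark), simulates_backMark ht, ?_⟩
      change τ ≠ none
      rintro rfl
      simp at hv
  | append_singleton u y ih =>
    intro x v ht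
    cases hx : x.left with
    | cons c l => exact main hx ht
    | nil =>
      obtain ⟨c', h1, h2, h3⟩ := ih (ht.unshift hx)
      rw [← nearTape_shift (ht.before y (by simp)) hx] at h2
      obtain ⟨m, hm⟩ := Sym.exists_holds (h := h) (x := x) (by
        rintro rfl
        simpa using ht.marked.eq_nil)
      rw [hx] at hm
      exact ⟨c', .head (yield_left (.backSkip hm)) h1, h2, h3⟩

theorem Simulates.exists_ready (hB : 1 ≤ B) (hh : ∀ a, (h a).length ≤ B)
    {c : (simATM M S h g q₀ B hS).Cfg} {d : Turing.TM0.Cfg Γ₀ Λ} (hc : Simulates h c d) :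
    ∃ c', Relation.ReflTransGen (simATM M S h g q₀ B hS).Yield c c' ∧
      Simulates h c' d ∧ Ready (h := h) c' := by
  cases hc with
  | run q ht => exact exists_ready_run ht
  | back q ht => exact exists_ready_back hB hh ht
  | @far q t ht =>
    obtain ⟨u, x, v⟩ := t
    by_cases hx : x = none
    · subst hx
      obtain rfl := ht.marked.eq_nil
      obtain ⟨c', h1, h2, h3⟩ := exists_ready_run (M := M) (g := g) (q₀ := q₀) (hS := hS) (q := q)
        (near_farTape ht).1
      rw [(near_farTape ht).2] at h2
      rcases h1.cases_head with rfl | ⟨b, hb, hbc⟩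
      · exact absurd rfl h3
      · refine ⟨c', .head ?_ hbc, h2, h3⟩
        obtain ⟨a, ha, hact⟩ := hb
        obtain ⟨p, t⟩ := b
        cases ha with
        | runSkip _ => exact ⟨_, .farMark, hact⟩
        | runHalt hm => cases hm.far
        | runWrite hm => cases hm.far
        | runRight hm => cases hm.far
        | runLeft hm => cases hm.far
    · exact ⟨_, .refl, .far q ht, hx⟩

theorem Simulates.complete (hB : 1 ≤ B) (hh : ∀ a, (h a).length ≤ B)
    (hM : ∀ {q a q' s}, (q', s) ∈ M q a → q ∈ S → q' ∈ S)
    {c : (simATM M S h g q₀ B hS).Cfg} {d : Turing.TM0.Cfg Γ₀ Λ} (hc : Simulates h c d) :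
    ∃ c', Relation.ReflTransGen (simATM M S h g q₀ B hS).Yield c c' ∧
      (c'.1 = .rej ∨ ∃ d', Turing.TM0.step M d = some d' ∧ Simulates h c' d') := by
  obtain ⟨c₁, h1, h2, h3⟩ := hc.exists_ready hB hh
  suffices ∃ c', (simATM M S h g q₀ B hS).Yield c₁ c' ∧
      (c'.1 = .rej ∨ ∃ d', Turing.TM0.step M d = some d' ∧ Simulates h c' d') by
    obtain ⟨c', h4, h5⟩ := this
    exact ⟨c', h1.tail h4, h5⟩
  cases h2 with
  | @run q t ht =>
    obtain ⟨u, x, v⟩ := t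
    obtain ⟨m, hx⟩ := Sym.exists_holds (h := h) (x := x) (by rintro rfl; exact h3 rfl)
    obtain ⟨e, r, hr⟩ := List.exists_cons_of_ne_nil h3
    rw [hr] at hx
    have hlen := hx.length_le hB hh
    rw [List.length_cons] at hlen
    cases he : M q e with
    | none => exact ⟨_, yield_write (.runHalt hx he), .inl rfl⟩
    | some p =>
      obtain ⟨q', s⟩ := p
      have hq' := hM he q.2
      rcases s with (_ | _) | e'
      · exact ⟨_, yield_write (.runLeft (q' := ⟨q', hq'⟩) hx he),
          .inr (simulates_left ht hx he)⟩
      · obtain ⟨y, hy⟩ := Sym.exists_holds_of_length (h := h) (l := e :: x.left) (r := r) (m := m)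
          (B := B) (by rw [List.length_cons]; omega)
        exact ⟨_, yield_write (.runRight (q' := ⟨q', hq'⟩) hx hy he),
          .inr (simulates_right ht hx hy he)⟩
      · obtain ⟨y, hy⟩ := Sym.exists_holds_of_length (h := h) (l := x.left) (r := e' :: r) (m := m)
          (B := B) (by rw [List.length_cons]; omega)
        exact ⟨_, yield_write (.runWrite (q' := ⟨q', hq'⟩) hx hy he),
          .inr (simulates_write ht hx hy he)⟩
  | back q ht => exact absurd h3 (by simp [Ready])
  | @far q t ht =>
    obtain ⟨u, x, v⟩ := t
    obtain ⟨m, hx⟩ := Sym.exists_holds (h := h) h3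
    rw [show x.left = [] from ht.scan] at hx
    have hlen := hx.length_le hB hh
    cases he : M q m with
    | none => exact ⟨_, yield_write (.farHalt hx he), .inl rfl⟩
    | some p =>
      obtain ⟨q', s⟩ := p
      have hq' := hM he q.2
      rcases s with (_ | _) | e'
      · cases v with
        | nil =>
          have h4 := simulates_farLeft (q := q) (q' := ⟨q', hq'⟩) ht.extend hx he
          rw [farTape_extend] at h4
          exact ⟨_, yield_right_nil (.farLeft (q' := ⟨q', hq'⟩) hx he), .inr h4⟩
        | cons τ v =>
          exact ⟨_, yield_right (.farLeft (q' := ⟨q', hq'⟩) hx he),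
            .inr (simulates_farLeft ht hx he)⟩
      · obtain ⟨u, τ, rfl⟩ := ht.marked.exists_concat h3
        exact ⟨_, yield_left (.farRight (q' := ⟨q', hq'⟩) hx he),
          .inr (simulates_farRight ht hx he)⟩
      · obtain ⟨y, hy⟩ := Sym.exists_holds_of_length (h := h) (l := []) (r := x.right h) (m := e')
          (B := B) hlen
        exact ⟨_, yield_write (.farWrite (q' := ⟨q', hq'⟩) hx hy he),
          .inr (simulates_farWrite ht hx hy he)⟩

/-- The simulating machine accepts an input if and only if the simulated machine does not halt on
the encoded input. -/
theorem mem_simATM_lang (hB : 1 ≤ B) (hh : ∀ a, (h a).length ≤ B) (hne : ∀ a, h a ≠ [])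
    (hM : ∀ {q a q' s}, (q', s) ∈ M q a → q ∈ S → q' ∈ S) (w : List α) :
    w ∈ (simATM M S h g q₀ B hS).Lang ↔
      ¬ (StateTransition.eval (Turing.TM0.step M)
        ⟨q₀, (biTape [] (w.flatMap h)).write (g (biTape [] (w.flatMap h)).head)⟩).Dom := by
  have hdom : ∀ d, (StateTransition.eval (Turing.TM0.step M) d).Dom ↔
      ∃ d', StateTransition.Reaches (Turing.TM0.step M) d d' ∧ Turing.TM0.step M d' = none := by
    simp only [Part.dom_iff_mem, StateTransition.mem_eval, implies_true]
  rw [simATM_isPiM.mem_lang_iff, hdom]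
  set T := biTape [] (w.flatMap h) with hT
  have hsetup : ∀ {x y : Sym α Γ₀ B} {v l c r m},
      x :: v = (if w = [] then [Sym.blank] else w.map fun a => some (.inl (some a))) →
      x.Holds h l (c :: r) m → y.Holds h l (g c :: r) m →
      Simulates h (.run q₀, [none], y, v) ⟨q₀, T.write (g T.head)⟩ := by
    intro x y v l c r m hxv hx hy
    obtain ⟨h1, h2⟩ := near_input (h := h) hxv
    obtain ⟨L, R, h3, h4⟩ := nearTape_eq [none] v hx
    have h5 : T = biTape (l ++ L) (c :: (r ++ R)) := by rw [hT, ← h2, h3]; rfl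
    rw [h5, biTape_head_cons, biTape_write, ← List.cons_append, ← h4 _ _ y hy]
    exact .run q₀ (h1.write hx hy)
  constructor
  · rintro H ⟨d', hd, hd'⟩
    suffices ∃ c, Relation.ReflTransGen (simATM M S h g q₀ B hS).Yield
        ((simATM M S h g q₀ B hS).init w) c ∧ c.1 = .rej by
      obtain ⟨c, h1, h2⟩ := this
      have := H c h1
      rw [ATM.cfgE, simATM_isE.2 h2] at this
      simp at this
    have key : ∀ d, Relation.ReflTransGen (fun a b => b ∈ Turing.TM0.step M a) d d' →
        ∀ c : (simATM M S h g q₀ B hS).Cfg, Simulates h c d → ∃ c',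
          Relation.ReflTransGen (simATM M S h g q₀ B hS).Yield c c' ∧ c'.1 = .rej := by
      intro d hd
      induction hd using Relation.ReflTransGen.head_induction_on with
      | refl =>
        intro c hc
        obtain ⟨c', h1, h2 | ⟨d'', h2, -⟩⟩ := hc.complete hB hh hM
        · exact ⟨c', h1, h2⟩
        · rw [hd'] at h2; cases h2
      | head hstep _ ih =>
        intro c hc
        obtain ⟨c', h1, h2 | ⟨d'', h2, h3⟩⟩ := hc.complete hB hh hM
        · exact ⟨c', h1, h2⟩
        · cases h2.symm.trans hstep
          obtain ⟨c'', h4, h5⟩ := ih c' h3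
          exact ⟨c'', h1.trans h4, h5⟩
    obtain ⟨x, v, hxv, hreach⟩ : ∃ x v,
        x :: v = (if w = [] then [Sym.blank] else w.map fun a => some (.inl (some a))) ∧
        Relation.ReflTransGen (simATM M S h g q₀ B hS).Yield
          ((simATM M S h g q₀ B hS).init w) (.setup, [none], x, v) := by
      cases w with
      | nil =>
        exact ⟨_, _, rfl, .head (yield_write (.start _)) (.single (yield_right_nil .setupMark))⟩
      | cons a w =>
        exact ⟨_, _, rfl, .head (yield_write (.start _)) (.single (yield_right .setupMark))⟩
    have hx0 : x.right h ≠ [] ∧ x ≠ none := by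
      split_ifs at hxv with hw
      · cases hxv; simp [Sym.right]
      · cases w with
        | nil => cases hxv
        | cons a w => cases hxv; simp [Sym.right, hne a]
    obtain ⟨m, hx⟩ := Sym.exists_holds (h := h) hx0.2
    obtain ⟨e, r, hr⟩ := List.exists_cons_of_ne_nil hx0.1
    rw [hr] at hx
    have hlen := hx.length_le hB hh
    obtain ⟨y, hy⟩ := Sym.exists_holds_of_length (h := h) (l := x.left) (r := g e :: r) (m := m)
      (B := B) hlen
    obtain ⟨c', h1, h2⟩ := key _ hd _ (hsetup hxv hx hy)
    exact ⟨c', hreach.trans (.head (yield_write (.setup hx hy)) h1), h2⟩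
  · intro H
    have inv : ∀ c, Relation.ReflTransGen (simATM M S h g q₀ B hS).Yield
        ((simATM M S h g q₀ B hS).init w) c →
        c = (simATM M S h g q₀ B hS).init w ∨
        c = (.setup, [], none, w.map fun a => some (.inl (some a))) ∨
        (∃ x v, x :: v = (if w = [] then [Sym.blank] else w.map fun a => some (.inl (some a))) ∧
          c = (.setup, [none], x, v)) ∨
        ∃ d, StateTransition.Reaches (Turing.TM0.step M) ⟨q₀, T.write (g T.head)⟩ d ∧
          Simulates h c d := by
      intro c hc
      induction hc with
      | refl => exact .inl rfl
      | @tail c c' _ hy ih =>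
        rcases ih with rfl | rfl | ⟨x, v, hxv, rfl⟩ | ⟨d, hd, hcd⟩
        · obtain ⟨a, ha, hact⟩ := hy
          obtain ⟨p, t⟩ := c'
          cases ha
          cases hact
          exact .inr (.inl rfl)
        · obtain ⟨a, ha, hact⟩ := hy
          obtain ⟨p, t⟩ := c'
          right; right; left
          cases ha with
          | setup hx => cases hx.far
          | setupMark =>
            cases w with
            | nil => cases hact; exact ⟨_, _, rfl, rfl⟩
            | cons a w => cases hact; exact ⟨_, _, rfl, rfl⟩
        · obtain ⟨a, ha, hact⟩ := hy
          obtain ⟨p, t⟩ := c'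
          cases ha with
          | setup hx hy =>
            cases hact
            exact .inr (.inr (.inr ⟨_, .refl, hsetup hxv hx hy⟩))
          | setupMark =>
            exact absurd rfl (marked_cons.1 (near_input (h := h) hxv).1.marked).2.2.1
        · rcases hcd.sound hy with h1 | ⟨d', h1, h2⟩ | h1
          · exact .inr (.inr (.inr ⟨d, hd, h1⟩))
          · exact .inr (.inr (.inr ⟨d', hd.tail h1, h2⟩))
          · exact absurd ⟨d, hd, h1⟩ H
    intro c hc
    by_contra hcon
    rw [Bool.not_eq_false, ATM.cfgE, simATM_isE] at hcon
    rcases inv c hc with rfl | rfl | ⟨x, v, -, rfl⟩ | ⟨d, -, hcd⟩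
    · cases hcon
    · cases hcon
    · cases hcon
    · cases hcd <;> cases hcon

end Simulation

end ATMPaper

namespace ATMPaper

open Turing

section Machine

open PartrecToTM2

instance : Finite K' := by
  refine Finite.of_surjective ![K'.main, .rev, .aux, .stack] ?_
  rintro (_ | _ | _ | _)
  exacts [⟨0, rfl⟩, ⟨1, rfl⟩, ⟨2, rfl⟩, ⟨3, rfl⟩]

/-- The tape alphabet of the machines computing partial recursive functions. -/
abbrev CodeSym : Type := TM2to1.Γ' K' fun _ => PartrecToTM2.Γ'

instance : Finite CodeSym := inferInstanceAs (Finite (Bool × (K' → Option PartrecToTM2.Γ')))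

/-- The tape symbol storing `s` on the main stack. -/
def mainSym (s : PartrecToTM2.Γ') : CodeSym :=
  (false, Function.update (fun _ => none) K'.main (some s))

/-- Mark a tape symbol as the bottom of the stacks. -/
def markBottom (s : CodeSym) : CodeSym := (true, s.2)

theorem trInit_eq (l : List PartrecToTM2.Γ') :
    TM2to1.trInit (Γ := fun _ => PartrecToTM2.Γ') K'.main l =
      markBottom (l.reverse.map mainSym).headI :: (l.reverse.map mainSym).tail := rfl

theorem mk₁_trInit (l : List PartrecToTM2.Γ') :
    Turing.Tape.mk₁ (TM2to1.trInit (Γ := fun _ => PartrecToTM2.Γ') K'.main l) =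
      (biTape [] (l.reverse.map mainSym)).write
        (markBottom (biTape [] (l.reverse.map mainSym)).head) := by
  rw [trInit_eq]
  cases l.reverse.map mainSym <;> rfl

/-- Every partial recursive function is computed by a single-tape machine using finitely many
states. -/
theorem exists_machine (c : ToPartrec.Code) :
    ∃ (Λ : Type) (_ : Inhabited Λ) (M : TM0.Machine CodeSym Λ) (S : Set Λ), S.Finite ∧
      TM0.Supports M S ∧ ∀ v : List ℕ, (StateTransition.eval (TM0.step M)
        ⟨default, Turing.Tape.mk₁ (TM2to1.trInit K'.main (trList v))⟩).Dom ↔ (c.eval v).Dom := by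
  let _ : Inhabited PartrecToTM2.Λ' := ⟨trNormal c .halt⟩
  refine ⟨TM1to0.Λ' (TM2to1.tr PartrecToTM2.tr), inferInstance, TM1to0.tr _, _,
    Finset.finite_toSet _, TM1to0.tr_supports _ (TM2to1.tr_supports _ (tr_supports c .halt)), ?_⟩
  intro v
  have h1 := TM2to1.tr_eval_dom PartrecToTM2.tr K'.main (trList v)
  rw [← TM1to0.tr_eval] at h1
  have h2 : TM2.init K'.main (trList v) = PartrecToTM2.init c v := by
    rw [TM2.init, PartrecToTM2.init]
    congr 1
    funext k
    cases k <;> rfl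
  have h3 : (TM2.eval PartrecToTM2.tr K'.main (trList v)).Dom ↔ (c.eval v).Dom := by
    change (StateTransition.eval (TM2.step PartrecToTM2.tr) (TM2.init K'.main (trList v))).Dom ↔ _
    rw [h2, PartrecToTM2.tr_eval]
    rfl
  exact h1.trans h3

end Machine

end ATMPaper

namespace ATMPaper

open Turing.ToPartrec

section Codes

theorem eval_comp {f g : Code} {v w : List ℕ} (hg : g.eval v = pure w) :
    (f.comp g).eval v = f.eval w := by
  rw [Code.comp_eval]
  exact (congrArg (fun x => Part.bind x f.eval) hg).trans (Part.bind_some _ _)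

theorem eval_cons {f g : Code} {v u w : List ℕ} (hf : f.eval v = pure u) (hg : g.eval v = pure w) :
    (f.cons g).eval v = pure (u.headI :: w) := by
  rw [Code.cons_eval]
  simp only [hf, hg]
  exact (Part.bind_some _ _).trans (Part.bind_some _ _)

/-- Every unary partial recursive function has a code. -/
theorem exists_code₁ {f : ℕ →. ℕ} (hf : Partrec f) :
    ∃ c : Code, ∀ n, c.eval [n] = pure <$> f n := by
  obtain ⟨c, hc⟩ := Code.exists_code (Nat.Partrec'.part_iff₁.2 hf)
  exact ⟨c, fun n => hc (n ::ᵥ List.Vector.nil)⟩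

/-- Every binary computable function has a code. -/
theorem exists_code₂ {f : ℕ → ℕ → ℕ} (hf : Computable₂ f) :
    ∃ c : Code, ∀ m n, c.eval [m, n] = pure [f m n] := by
  obtain ⟨c, hc⟩ := Code.exists_code (Nat.Partrec'.part_iff₂.2 hf.partrec₂)
  exact ⟨c, fun m n => (hc (m ::ᵥ n ::ᵥ List.Vector.nil)).trans (Part.map_some _ _)⟩

/-- Every binary computable function can be folded over a list of positive numbers. -/
theorem exists_code_foldl {f : ℕ → ℕ → ℕ} (hf : Computable₂ f) (h0 : ∀ m, f m 0 = m) :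
    ∃ c : Code, ∀ (v : List ℕ), (∀ n ∈ v, n ≠ 0) → ∀ m, c.eval (m :: v) = pure [v.foldl f m] := by
  obtain ⟨c, hc⟩ := exists_code₂ hf
  let body : Code := .cons (Code.head.comp .tail) (.cons
    (c.comp (.cons .head (.cons (Code.head.comp .tail) .nil))) (Code.tail.comp .tail))
  have hbody : ∀ m v, body.eval (m :: v) = pure (v.headI :: f m v.headI :: v.tail) := by
    intro m v
    have h1 : (Code.head.comp .tail).eval (m :: v) = pure [v.headI] :=
      (eval_comp (w := v) (by simp)).trans (by simp)
    refine eval_cons (u := [v.headI]) h1 (eval_cons (u := [f m v.headI]) ?_ ?_)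
    · exact (eval_comp (eval_cons (Code.head_eval _) (eval_cons h1 (Code.nil_eval _)))).trans
        (hc _ _)
    · exact (eval_comp (w := v) (by simp)).trans (by simp)
  refine ⟨.fix body, ?_⟩
  intro v
  induction v with
  | nil =>
    intro _ m
    rw [Code.fix_eval]
    refine Part.eq_some_iff.2 (PFun.mem_fix_iff.2 (.inl ?_))
    rw [hbody]
    exact (Part.mem_map_iff _).2 ⟨_, Part.mem_some _, by simp [h0]⟩
  | cons n v ih =>
    intro hv m
    rw [Code.fix_eval] at ih ⊢
    refine Part.eq_some_iff.2 (PFun.mem_fix_iff.2 (.inr ⟨f m n :: v, ?_, ?_⟩))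
    · rw [hbody]
      exact (Part.mem_map_iff _).2 ⟨_, Part.mem_some _, by simp [hv n (by simp)]⟩
    · exact Part.eq_some_iff.1 (ih (fun k hk => hv k (by simp [hk])) (f m n))

variable {α : Type} [Primcodable α]

/-- There is a code computing the encoding of a list from the encodings of its entries. -/
theorem exists_code_encode : ∃ c : Code, ∀ w : List α,
    c.eval (w.reverse.map fun a => Encodable.encode a + 1) = pure [Encodable.encode w] := by
  let f : ℕ → ℕ → ℕ := fun m n => Nat.casesOn n m fun k =>
    (((Encodable.decode (α := List α) m).bind fun u => (Encodable.decode (α := α) k).map fun a =>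
      Encodable.encode (a :: u)).getD 0)
  have hf : Primrec₂ f := by
    refine Primrec.nat_casesOn (α := ℕ × ℕ) (f := Prod.snd) (g := Prod.fst)
      (h := fun p k => (((Encodable.decode (α := List α) p.1).bind fun u =>
        (Encodable.decode (α := α) k).map fun a => Encodable.encode (a :: u)).getD 0))
      Primrec.snd Primrec.fst ?_
    refine Primrec.option_getD.comp (Primrec.option_bind
      (Primrec.decode.comp (Primrec.fst.comp Primrec.fst)) ?_) (Primrec.const 0)
    refine Primrec.option_map (Primrec.decode.comp (Primrec.snd.comp Primrec.fst)) ?_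
    exact Primrec.encode.comp (Primrec.list_cons.comp Primrec.snd
      (Primrec.snd.comp Primrec.fst))
  obtain ⟨c, hc⟩ := exists_code_foldl hf.to_comp fun _ => rfl
  refine ⟨c.comp .zero', fun w => ?_⟩
  have key : (w.reverse.map fun a => Encodable.encode a + 1).foldl f 0 = Encodable.encode w := by
    induction w with
    | nil => rfl
    | cons a w ih =>
      rw [List.reverse_cons, List.map_append, List.foldl_append, ih]
      simp [f]
  rw [← key, ← hc _ (by simp)]
  exact eval_comp (by simp)

/-- There is a code defined exactly at the strings outside a given co-computably-enumerable
language. -/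
theorem exists_code_compl {R : List α × List α → Prop} (hR : ComputablePred R) :
    ∃ c : Code, ∀ w : List α,
      (c.eval (w.reverse.map fun a => Encodable.encode a + 1)).Dom ↔ ∃ x, ¬ R (w, x) := by
  obtain ⟨_, hR⟩ := hR
  let p : List α → ℕ → Bool := fun w n =>
    ((Encodable.decode (α := List α) n).map fun x => !decide (R (w, x))).getD false
  have hp : Computable₂ p := by
    refine Computable.option_getD (Computable.option_map (Computable.decode.comp Computable.snd) ?_)
      (Computable.const false)
    exact Primrec.not.to_comp.comp (hR.comp ((Computable.fst.comp Computable.fst).pair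
      Computable.snd))
  have hq : Partrec fun n : ℕ => (Encodable.decode (α := List α) n : Part (List α)).bind fun w =>
      Nat.rfind fun n => Part.some (p w n) :=
    Partrec.bind (Computable.ofOption Computable.decode)
      ((Partrec.rfind hp.partrec₂).comp Computable.snd)
  obtain ⟨c₁, h₁⟩ := exists_code₁ hq
  obtain ⟨c₂, h₂⟩ := exists_code_encode (α := α)
  refine ⟨c₁.comp c₂, fun w => ?_⟩
  have : (c₁.comp c₂).eval (w.reverse.map fun a => Encodable.encode a + 1) =
      (pure <$> Nat.rfind fun n => Part.some (p w n)) := by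
    rw [eval_comp (h₂ w), h₁, Encodable.encodek]
    exact congrArg _ (Part.bind_some _ _)
  rw [this]
  refine Nat.rfind_dom.trans ?_
  constructor
  · rintro ⟨n, hn, -⟩
    simp only [Part.mem_some_iff, p] at hn
    cases hd : Encodable.decode (α := List α) n with
    | none => simp [hd] at hn
    | some x => exact ⟨x, by simpa [hd] using hn⟩
  · rintro ⟨x, hx⟩
    exact ⟨Encodable.encode x, by simp [p, hx], fun _ => trivial⟩

end Codes

end ATMPaper

namespace ATMPaper

open Turing

section Main

variable {α : Type} [Primcodable α]

/-- The part of the main stack encoding an input letter. -/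
def letterSyms (a : α) : List CodeSym :=
  (PartrecToTM2.trNat (Encodable.encode a + 1) ++ [PartrecToTM2.Γ'.cons]).reverse.map mainSym

theorem trList_eq_flatMap (v : List ℕ) :
    PartrecToTM2.trList v =
      v.flatMap fun n => PartrecToTM2.trNat n ++ [PartrecToTM2.Γ'.cons] := by
  induction v with
  | nil => rfl
  | cons n v ih => simp [PartrecToTM2.trList, ih]

theorem flatMap_letterSyms (w : List α) :
    w.flatMap letterSyms = (PartrecToTM2.trList
      (w.reverse.map fun a => Encodable.encode a + 1)).reverse.map mainSym := by
  rw [trList_eq_flatMap, List.reverse_flatMap, List.map_flatMap, ← List.map_reverse,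
    List.reverse_reverse, List.flatMap_map]
  rfl

/-- Every co-computably-enumerable language is accepted by a `Π₁` machine. -/
theorem exists_isPiM_one [Finite α] {R : List α × List α → Prop} (hR : ComputablePred R) :
    ∃ (Γ : Type) (M : ATM α Γ), M.IsPiM 1 ∧ {w | ∀ x, R (w, x)} = M.Lang := by
  have := Fintype.ofFinite α
  obtain ⟨c, hc⟩ := exists_code_compl hR
  obtain ⟨Λ, _, N, S, hS, hN, hdom⟩ := exists_machine c
  let B := 1 + ∑ a : α, (letterSyms a).length
  have hB : ∀ a : α, (letterSyms a).length ≤ B := fun a =>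
    (Finset.single_le_sum (f := fun a : α => (letterSyms a).length) (fun _ _ => Nat.zero_le _)
      (Finset.mem_univ a)).trans (Nat.le_add_left _ _)
  refine ⟨_, simATM N S letterSyms markBottom ⟨default, hN.1⟩ B hS, simATM_isPiM, ?_⟩
  ext w
  have h1 := mem_simATM_lang (M := N) (g := markBottom)
    (q₀ := ⟨default, hN.1⟩) (hS := hS) (Nat.le_add_right _ _) hB (by simp [letterSyms])
    (fun hq => hN.2 hq) w
  rw [flatMap_letterSyms, ← mk₁_trInit, hdom, hc] at h1
  rw [h1]
  simp

/-- The language of a `Π₁` machine is co-computably-enumerable. -/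
theorem exists_computablePred [Finite α] {Γ : Type} (M : ATM α Γ) (h : M.IsPiM 1) :
    ∃ R : List α × List α → Prop, ComputablePred R ∧ M.Lang = {w | ∀ x, R (w, x)} := by
  cases isEmpty_or_nonempty α with
  | inr _ => exact ATM.pi01_of_isPiM M h
  | inl _ =>
    classical
    refine ⟨fun _ => [] ∈ M.Lang, ⟨inferInstance, Computable.const (decide ([] ∈ M.Lang))⟩, ?_⟩
    ext w
    simp [Subsingleton.elim w []]

end Main

end ATMPaper

open ATMPaper in
/-- a language `L ⊆ Σ*` is `Π⁰₁` (co-computably-enumerable) iff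
`L = L(M)` for some `Π₁` alternating Turing machine `M`. -/
theorem stmt12 {α : Type} [Fintype α] [Primcodable α] (L : Set (List α)) :
    (∃ R : List α × List α → Prop, ComputablePred R ∧
        L = {w | ∀ x : List α, R (w, x)}) ↔
      ∃ (Γ : Type) (M : ATM α Γ), M.IsPiM 1 ∧ L = M.Lang := by
  constructor
  · rintro ⟨R, hR, rfl⟩
    exact exists_isPiM_one hR
  · rintro ⟨Γ, M, hM, rfl⟩
    exact exists_computablePred M hM
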